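/- arXiv:2402.13416 — 3 statements merged into one kernel-verified Lean document; each statement's English description precedes it below -/
import Mathlib

section
/- Let X and Y be normed spaces over 𝔽 ∈ {ℝ, ℂ}, with X finite-dimensional, and let Φ : ℙX → ℙY be a bijection such that for all [x], [x'] ∈ ℙX one has [x] ⊥ [x'] if and only if Φ([x]) ⊥ Φ([x']). Then Y is finite-dimensional, dim X = dim Y, and Φ maps smooth projective points of ℙX onto smooth projective points of ℙY. -/
/-- Birkhoff–James orthogonality. -/
def BJOrtho (𝕜 : Type*) [RCLike 𝕜] {X : Type*} [NormedAddCommGroup X] [NormedSpace 𝕜 X]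
    (x y : X) : Prop :=
  ∀ c : 𝕜, ‖x‖ ≤ ‖x + c • y‖

/-- `f` is a supporting functional of `x`. -/
def IsSuppFun (𝕜 : Type*) [RCLike 𝕜] {X : Type*} [NormedAddCommGroup X] [NormedSpace 𝕜 X]
    (f : X →L[𝕜] 𝕜) (x : X) : Prop :=
  ‖f‖ = 1 ∧ f x = (‖x‖ : 𝕜)

/-- `x` is a smooth point: it is nonzero and has exactly one supporting functional. -/
def IsSmoothPt (𝕜 : Type*) [RCLike 𝕜] {X : Type*} [NormedAddCommGroup X] [NormedSpace 𝕜 X]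
    (x : X) : Prop :=
  x ≠ 0 ∧ ∃! f : X →L[𝕜] 𝕜, IsSuppFun 𝕜 f x

/-- Birkhoff–James orthogonality on the projective space, via representatives
(well defined since BJ-orthogonality is homogeneous). -/
def BJP (𝕜 : Type*) [RCLike 𝕜] {X : Type*} [NormedAddCommGroup X] [NormedSpace 𝕜 X]
    (p q : Projectivization 𝕜 X) : Prop :=
  BJOrtho 𝕜 p.rep q.rep

section Orthogonality

variable {𝕜 : Type*} [RCLike 𝕜] {X : Type*} [NormedAddCommGroup X] [NormedSpace 𝕜 X]

theorem BJOrtho.smul_right {x y : X} (h : BJOrtho 𝕜 x y) (a : 𝕜) : BJOrtho 𝕜 x (a • y) := by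
  intro c
  rw [smul_smul]
  exact h _

theorem BJOrtho.eq_zero_of_self {x : X} (h : BJOrtho 𝕜 x x) : x = 0 := by
  have := h (-1)
  simpa using this

theorem isClosed_setOf_bjOrtho (y : X) : IsClosed {x : X | BJOrtho 𝕜 x y} := by
  simp only [BJOrtho, Set.ofPred_forall]
  exact isClosed_iInter fun c => isClosed_le (by fun_prop) (by fun_prop)

theorem IsSuppFun.norm_apply_le {f : X →L[𝕜] 𝕜} {x : X} (hf : IsSuppFun 𝕜 f x) (y : X) :
    ‖f y‖ ≤ ‖y‖ := by
  simpa [hf.1] using f.le_opNorm y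

theorem IsSuppFun.bjOrtho {f : X →L[𝕜] 𝕜} {x y : X} (hf : IsSuppFun 𝕜 f x) (hy : f y = 0) :
    BJOrtho 𝕜 x y := by
  intro c
  have h := hf.norm_apply_le (x + c • y)
  simpa [hf.2, hy] using h

theorem exists_isSuppFun {x : X} (hx : x ≠ 0) : ∃ f : X →L[𝕜] 𝕜, IsSuppFun 𝕜 f x :=
  exists_dual_vector 𝕜 x (norm_ne_zero_iff.2 hx)

/-- James' characterization of orthogonality through supporting functionals. -/
theorem BJOrtho.exists_isSuppFun {x y : X} (hx : x ≠ 0) (h : BJOrtho 𝕜 x y) :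
    ∃ f : X →L[𝕜] 𝕜, IsSuppFun 𝕜 f x ∧ f y = 0 := by
  let S : Submodule 𝕜 X := 𝕜 ∙ y
  have hnorm : ‖S.mkQ x‖ = ‖x‖ := by
    refine le_antisymm (Submodule.Quotient.norm_mk_le S x) ?_
    refine (QuotientAddGroup.le_norm_iff (S := S.toAddSubgroup)
      (x := (QuotientAddGroup.mk x))).2 ?_
    intro m hm
    have hm' : m - x ∈ S := (Submodule.Quotient.eq S).1 hm
    obtain ⟨c, hc⟩ := Submodule.mem_span_singleton.1 hm'
    have : m = x + c • y := by rw [hc]; abel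
    rw [this]
    exact h c
  obtain ⟨g, hg, hgx⟩ := exists_dual_vector'' 𝕜 (S.mkQ x)
  have hle : ∀ z, ‖(g.comp S.mkQL) z‖ ≤ 1 * ‖z‖ := fun z =>
    (g.le_opNorm _).trans (mul_le_mul hg (Submodule.Quotient.norm_mk_le S z)
      (norm_nonneg _) zero_le_one)
  have hx' : (g.comp S.mkQL) x = (‖x‖ : 𝕜) := by
    rw [hnorm] at hgx
    exact hgx
  refine ⟨g.comp S.mkQL, ⟨le_antisymm ?_ ?_, hx'⟩, ?_⟩
  · exact ContinuousLinearMap.opNorm_le_bound _ zero_le_one hle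
  · have h1 := (g.comp S.mkQL).le_opNorm x
    rw [hx', RCLike.norm_ofReal, abs_norm] at h1
    exact le_of_mul_le_mul_right (by simpa using h1) (norm_pos_iff.2 hx)
  · have : S.mkQ y = 0 :=
      (Submodule.Quotient.mk_eq_zero S).2 (Submodule.mem_span_singleton_self y)
    change g (S.mkQ y) = 0
    rw [this, map_zero]

theorem IsSmoothPt.apply_eq_zero {f : X →L[𝕜] 𝕜} {x y : X} (hx : IsSmoothPt 𝕜 x)
    (hf : IsSuppFun 𝕜 f x) (h : BJOrtho 𝕜 x y) : f y = 0 := by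
  obtain ⟨g, hg, hgy⟩ := h.exists_isSuppFun hx.1
  rw [hx.2.unique hf hg, hgy]

theorem IsSuppFun.smul_of_smul {f : X →L[𝕜] 𝕜} {x : X} {a : 𝕜} (ha : a ≠ 0)
    (hf : IsSuppFun 𝕜 f (a • x)) : IsSuppFun 𝕜 ((a / (‖a‖ : 𝕜)) • f) x := by
  have hna : (‖a‖ : 𝕜) ≠ 0 := by simpa using ha
  have hfx := hf.2
  rw [map_smul, smul_eq_mul, norm_smul, RCLike.ofReal_mul] at hfx
  refine ⟨?_, ?_⟩
  · rw [norm_smul, hf.1, norm_div, RCLike.norm_ofReal, abs_norm, div_self (norm_ne_zero_iff.2 ha),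
      mul_one]
  · rw [smul_apply, smul_eq_mul, div_mul_eq_mul_div, hfx,
      mul_div_cancel_left₀ _ hna]

theorem IsSmoothPt.smul {x : X} (hx : IsSmoothPt 𝕜 x) {a : 𝕜} (ha : a ≠ 0) :
    IsSmoothPt 𝕜 (a • x) := by
  have hax : a • x ≠ 0 := smul_ne_zero ha hx.1
  obtain ⟨f, hf⟩ := exists_isSuppFun (𝕜 := 𝕜) hax
  refine ⟨hax, f, hf, fun g hg => ?_⟩
  have hna : (‖a‖ : 𝕜) ≠ 0 := by simpa using ha
  have h := hx.2.unique (hg.smul_of_smul ha) (hf.smul_of_smul ha)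
  ext y
  have hy := congrArg (fun φ : X →L[𝕜] 𝕜 => φ y) h
  exact mul_left_cancel₀ (div_ne_zero ha hna) hy

theorem isSmoothPt_of_differentiableAt_norm [NormedSpace ℝ X] [IsScalarTower ℝ 𝕜 X] {x : X}
    (hx : x ≠ 0) (hd : DifferentiableAt ℝ (‖·‖) x) : IsSmoothPt 𝕜 x := by
  have key : ∀ f : X →L[𝕜] 𝕜, IsSuppFun 𝕜 f x → ∀ y, RCLike.re (f y) = fderiv ℝ (‖·‖) x y := by
    intro f hf y
    have hmin : IsLocalMin (fun z : X => ‖z‖ - (RCLike.reCLM.comp (f.restrictScalars ℝ)) z) x := by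
      refine Filter.Eventually.of_forall fun z => ?_
      have h1 : RCLike.re (f z) ≤ ‖z‖ := (RCLike.re_le_norm _).trans (hf.norm_apply_le z)
      simpa [hf.2] using h1
    have hder := hmin.hasFDerivAt_eq_zero
      (hd.hasFDerivAt.sub (RCLike.reCLM.comp (f.restrictScalars ℝ)).hasFDerivAt)
    have := congrArg (fun L : X →L[ℝ] ℝ => L y) hder
    simp only [sub_apply, zero_apply] at this
    exact (sub_eq_zero.1 this).symm
  obtain ⟨f, hf⟩ := exists_isSuppFun (𝕜 := 𝕜) hx
  refine ⟨hx, f, hf, fun g hg => ?_⟩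
  have hre : ∀ y, RCLike.re (g y) = RCLike.re (f y) := fun y => by rw [key g hg, key f hf]
  ext y
  refine RCLike.ext (hre y) ?_
  have h := hre ((RCLike.I : 𝕜) • y)
  simpa using h

theorem eq_zero_of_forall_isSmoothPt_bjOrtho [FiniteDimensional 𝕜 X] {y : X}
    (h : ∀ x : X, IsSmoothPt 𝕜 x → BJOrtho 𝕜 x y) : y = 0 := by
  let _ : NormedSpace ℝ X := NormedSpace.restrictScalars ℝ 𝕜 X
  have : IsScalarTower ℝ 𝕜 X := IsScalarTower.of_algebraMap_smul fun _ _ => rfl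
  have : FiniteDimensional ℝ X := FiniteDimensional.trans ℝ 𝕜 X
  have hsub : {x : X | DifferentiableAt ℝ (‖·‖) x} ⊆ {x : X | BJOrtho 𝕜 x y} := by
    intro x hx
    by_cases hx0 : x = 0
    · intro c
      simp [hx0]
    · exact h x (isSmoothPt_of_differentiableAt_norm hx0 hx)
  have hy : y ∈ {x : X | BJOrtho 𝕜 x y} :=
    (isClosed_setOf_bjOrtho y).closure_subset_iff.2 hsub (dense_differentiableAt_norm y)
  exact BJOrtho.eq_zero_of_self hy

theorem bjp_mk_iff (p : Projectivization 𝕜 X) {y : X} (hy : y ≠ 0) :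
    BJP 𝕜 p (Projectivization.mk 𝕜 y hy) ↔ BJOrtho 𝕜 p.rep y := by
  obtain ⟨a, ha⟩ := Projectivization.exists_smul_eq_mk_rep 𝕜 y hy
  rw [BJP, ← ha, Units.smul_def]
  refine ⟨fun h => ?_, fun h => h.smul_right _⟩
  have := h.smul_right (a : 𝕜)⁻¹
  rwa [inv_smul_smul₀ a.ne_zero] at this

theorem exists_isSmoothPt_rep_not_bjOrtho [FiniteDimensional 𝕜 X] {y : X} (hy : y ≠ 0) :
    ∃ p : Projectivization 𝕜 X, IsSmoothPt 𝕜 p.rep ∧ ¬ BJOrtho 𝕜 p.rep y := by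
  by_contra! H
  refine hy (eq_zero_of_forall_isSmoothPt_bjOrtho (𝕜 := 𝕜) fun x hx => ?_)
  obtain ⟨a, ha⟩ := Projectivization.exists_smul_eq_mk_rep 𝕜 x hx.1
  rw [Units.smul_def] at ha
  have h := H (Projectivization.mk 𝕜 x hx.1) (ha ▸ hx.smul a.ne_zero)
  rw [← ha] at h
  intro c
  have hc := h (a * c)
  rw [mul_smul, ← smul_add, norm_smul, norm_smul] at hc
  exact le_of_mul_le_mul_left hc (norm_pos_iff.2 a.ne_zero)

theorem finiteDimensional_and_finrank_le_of_forall_not_bjp {ι : Type*} [Fintype ι]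
    (v : ι → Projectivization 𝕜 X) (h : ∀ q, ¬ ∀ i, BJP 𝕜 (v i) q) :
    FiniteDimensional 𝕜 X ∧ Module.finrank 𝕜 X ≤ Fintype.card ι := by
  choose f hf using fun i => exists_isSuppFun (𝕜 := 𝕜) (v i).rep_nonzero
  let L : X →ₗ[𝕜] ι → 𝕜 := LinearMap.pi fun i => (f i : X →ₗ[𝕜] 𝕜)
  have hL : Function.Injective L := by
    refine (injective_iff_map_eq_zero L).2 fun y hy => ?_
    by_contra hy0
    exact h (Projectivization.mk 𝕜 y hy0) fun i =>
      (bjp_mk_iff _ hy0).2 ((hf i).bjOrtho (congrFun hy i))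
  refine ⟨FiniteDimensional.of_injective L hL, ?_⟩
  simpa using LinearMap.finrank_le_finrank_of_injective hL

end Orthogonality

/-- There are `n` points including `p` that are not simultaneously related to any point, such that
dropping one point other than `p` leaves at most one point to which the rest are related. -/
def HasSeparatingFamily {P : Type*} (R : P → P → Prop) (n : ℕ) (p : P) : Prop :=
  ∃ (v : Fin n → P) (k : Fin n), v k = p ∧ (∀ q, ¬ ∀ i, R (v i) q) ∧
    ∀ i ≠ k, ∀ q q', (∀ j ≠ i, R (v j) q) → (∀ j ≠ i, R (v j) q') → q = q'

theorem HasSeparatingFamily.map {P Q : Type*} {R : P → P → Prop} {T : Q → Q → Prop} {n : ℕ}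
    (e : P ≃ Q) (he : ∀ p q, R p q ↔ T (e p) (e q)) {p : P} (h : HasSeparatingFamily R n p) :
    HasSeparatingFamily T n (e p) := by
  obtain ⟨v, k, hk, h1, h2⟩ := h
  have he' : ∀ p q, T (e p) q ↔ R p (e.symm q) := fun p q => by simp [he]
  refine ⟨e ∘ v, k, by simp [hk], fun q hq => h1 (e.symm q) fun i => (he' _ _).1 (hq i), ?_⟩
  intro i hi q q' hq hq'
  exact e.symm.injective (h2 i hi _ _ (fun j hj => (he' _ _).1 (hq j hj))
    fun j hj => (he' _ _).1 (hq' j hj))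

section Smoothness

variable {𝕜 : Type*} [RCLike 𝕜] {X : Type*} [NormedAddCommGroup X] [NormedSpace 𝕜 X]
  [FiniteDimensional 𝕜 X]

theorem exists_dualBasis_isSuppFun {p : Projectivization 𝕜 X} {f : X →L[𝕜] 𝕜}
    (hp : IsSmoothPt 𝕜 p.rep) (hf : IsSuppFun 𝕜 f p.rep) :
    ∃ (B : Module.Basis (Fin (Module.finrank 𝕜 X)) 𝕜 (Module.Dual 𝕜 X))
      (k : Fin (Module.finrank 𝕜 X)), B k = (f : X →ₗ[𝕜] 𝕜) ∧
      ∀ i, ∃ (q : Projectivization 𝕜 X) (g : X →L[𝕜] 𝕜), IsSmoothPt 𝕜 q.rep ∧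
        IsSuppFun 𝕜 g q.rep ∧ B i = (g : X →ₗ[𝕜] 𝕜) := by
  let S : Set (Module.Dual 𝕜 X) := {φ | ∃ (q : Projectivization 𝕜 X) (g : X →L[𝕜] 𝕜),
    IsSmoothPt 𝕜 q.rep ∧ IsSuppFun 𝕜 g q.rep ∧ φ = (g : X →ₗ[𝕜] 𝕜)}
  have hfS : (f : X →ₗ[𝕜] 𝕜) ∈ S := ⟨p, f, hp, hf, rfl⟩
  have hf0 : (f : X →ₗ[𝕜] 𝕜) ≠ 0 := by
    intro h
    have h1 : f p.rep = 0 := congrArg (fun φ : X →ₗ[𝕜] 𝕜 => φ p.rep) h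
    rw [hf.2] at h1
    exact p.rep_nonzero (by simpa using h1)
  have hS : Submodule.span 𝕜 S = ⊤ := by
    have hco : (Submodule.span 𝕜 S).dualCoannihilator = ⊥ := by
      refine (Submodule.eq_bot_iff _).2 fun y hy => ?_
      by_contra hy0
      obtain ⟨q, hq, hqy⟩ := exists_isSmoothPt_rep_not_bjOrtho (𝕜 := 𝕜) hy0
      obtain ⟨g, hg⟩ := exists_isSuppFun (𝕜 := 𝕜) hq.1
      exact hqy (hg.bjOrtho ((Submodule.mem_dualCoannihilator _).1 hy (g : X →ₗ[𝕜] 𝕜)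
        (Submodule.subset_span ⟨q, g, hq, hg, rfl⟩)))
    have := Subspace.dualCoannihilator_dualAnnihilator_eq (W := Submodule.span 𝕜 S)
    rw [← this, hco, Submodule.dualAnnihilator_bot]
  obtain ⟨b, hbS, hfb, hSb, hb⟩ := exists_linearIndepOn_id_extension
    (LinearIndepOn.singleton (R := 𝕜) (v := id) hf0) (Set.singleton_subset_iff.2 hfS)
  have hspan : ⊤ ≤ Submodule.span 𝕜 (Set.range ((↑) : b → Module.Dual 𝕜 X)) := by
    rw [Subtype.range_coe, ← hS]
    exact Submodule.span_le.2 hSb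
  let B₀ : Module.Basis b 𝕜 (Module.Dual 𝕜 X) := Module.Basis.mk hb hspan
  let _ : Fintype b := FiniteDimensional.fintypeBasisIndex B₀
  have hcard : Fintype.card b = Module.finrank 𝕜 X := by
    rw [← Subspace.dual_finrank_eq, Module.finrank_eq_card_basis B₀]
  let e := Fintype.equivFinOfCardEq hcard
  have hBe : ∀ i, (B₀.reindex e) i = ((e.symm i : b) : Module.Dual 𝕜 X) := fun i => by
    simp [B₀]
  refine ⟨B₀.reindex e, e ⟨f, hfb rfl⟩, by simp [hBe], fun i => ?_⟩
  rw [hBe]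
  exact hbS (e.symm i).2

theorem IsSmoothPt.hasSeparatingFamily {p : Projectivization 𝕜 X} (hp : IsSmoothPt 𝕜 p.rep) :
    HasSeparatingFamily (BJP 𝕜) (Module.finrank 𝕜 X) p := by
  obtain ⟨f, hf⟩ := exists_isSuppFun (𝕜 := 𝕜) hp.1
  obtain ⟨B, k, hk, hB⟩ := exists_dualBasis_isSuppFun hp hf
  have hB' : ∀ i, ∃ q : Projectivization 𝕜 X, (i = k → q = p) ∧
      ∀ y, BJOrtho 𝕜 q.rep y → B i y = 0 := by
    intro i
    by_cases hi : i = k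
    · refine ⟨p, fun _ => rfl, fun y hy => ?_⟩
      rw [hi, hk]
      exact hp.apply_eq_zero hf hy
    · obtain ⟨q, g, hq, hg, hig⟩ := hB i
      refine ⟨q, fun h => absurd h hi, fun y hy => ?_⟩
      rw [hig]
      exact hq.apply_eq_zero hg hy
  choose v hvk hv using hB'
  have hzero : ∀ y : X, (∀ i, B i y = 0) → y = 0 := by
    intro y hy
    refine (Module.forall_dual_apply_eq_zero_iff 𝕜 y).1 fun φ => ?_
    have : Module.Dual.eval 𝕜 X y = 0 := B.ext fun i => by simpa using hy i
    simpa using congrArg (fun ψ : Module.Dual 𝕜 (Module.Dual 𝕜 X) => ψ φ) this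
  refine ⟨v, k, hvk k rfl, fun q hq => q.rep_nonzero (hzero _ fun i => hv i _ (hq i)), ?_⟩
  intro i _ q q' hq hq'
  have hne : ∀ r : Projectivization 𝕜 X, (∀ j ≠ i, BJP 𝕜 (v j) r) → B i r.rep ≠ 0 := by
    intro r hr h0
    refine r.rep_nonzero (hzero _ fun j => ?_)
    by_cases hj : j = i
    · rw [hj, h0]
    · exact hv j _ (hr j hj)
  have hsub : B i q'.rep • q.rep - B i q.rep • q'.rep = 0 := by
    refine hzero _ fun j => ?_
    by_cases hj : j = i
    · rw [hj]
      simp [mul_comm]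
    · simp [hv j _ (hq j hj), hv j _ (hq' j hj)]
  rw [← q.mk_rep, ← q'.mk_rep, Projectivization.mk_eq_mk_iff']
  refine ⟨(B i q'.rep)⁻¹ * B i q.rep, ?_⟩
  rw [mul_smul, ← sub_eq_zero.1 hsub, inv_smul_smul₀ (hne q' hq')]

theorem HasSeparatingFamily.isSmoothPt {p : Projectivization 𝕜 X}
    (h : HasSeparatingFamily (BJP 𝕜) (Module.finrank 𝕜 X) p) : IsSmoothPt 𝕜 p.rep := by
  obtain ⟨v, k, rfl, hv, huniq⟩ := h
  have hbij : ∀ F : Fin (Module.finrank 𝕜 X) → X →L[𝕜] 𝕜, (∀ i, IsSuppFun 𝕜 (F i) (v i).rep) →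
      Function.Bijective (LinearMap.pi fun i => (F i : X →ₗ[𝕜] 𝕜)) := by
    intro F hF
    have hinj : Function.Injective (LinearMap.pi fun i => (F i : X →ₗ[𝕜] 𝕜)) := by
      refine (injective_iff_map_eq_zero _).2 fun y hy => ?_
      by_contra hy0
      exact hv (Projectivization.mk 𝕜 y hy0) fun i =>
        (bjp_mk_iff _ hy0).2 ((hF i).bjOrtho (congrFun hy i))
    exact ⟨hinj, (LinearMap.injective_iff_surjective_of_finrank_eq_finrank (by simp)).1 hinj⟩
  choose F hF using fun i => exists_isSuppFun (𝕜 := 𝕜) (v i).rep_nonzero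
  refine ⟨(v k).rep_nonzero, F k, hF k, fun g hg => ?_⟩
  let G := Function.update F k g
  have hGk : G k = g := Function.update_self _ _ _
  have hG : ∀ i, IsSuppFun 𝕜 (G i) (v i).rep := by
    intro i
    by_cases hi : i = k
    · subst hi
      rwa [hGk]
    · have : G i = F i := Function.update_of_ne hi _ _
      rw [this]
      exact hF i
  have hdual : ∀ i, ∃ y : X, ∀ j, F j y = (Pi.single i 1 : Fin _ → 𝕜) j := fun i => by
    obtain ⟨y, hy⟩ := (hbij F hF).2 (Pi.single i 1)
    exact ⟨y, fun j => congrFun hy j⟩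
  have hdual' : ∀ i, ∃ y : X, ∀ j, G j y = (Pi.single i 1 : Fin _ → 𝕜) j := fun i => by
    obtain ⟨y, hy⟩ := (hbij G hG).2 (Pi.single i 1)
    exact ⟨y, fun j => congrFun hy j⟩
  choose e he using hdual
  choose e' he' using hdual'
  have hge : ∀ i ≠ k, g (e i) = 0 := by
    intro i hi
    have hne : e i ≠ 0 := by
      intro h0
      have := he i i
      simp [h0] at this
    have hne' : e' i ≠ 0 := by
      intro h0
      have := he' i i
      simp [h0] at this
    have heq := huniq i hi (Projectivization.mk 𝕜 (e i) hne) (Projectivization.mk 𝕜 (e' i) hne')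
      (fun j hj => (bjp_mk_iff _ hne).2 ((hF j).bjOrtho (by simp [he, hj])))
      (fun j hj => (bjp_mk_iff _ hne').2 ((hG j).bjOrtho (by simp [he', hj])))
    obtain ⟨a, ha⟩ := (Projectivization.mk_eq_mk_iff' 𝕜 _ _ hne hne').1 heq
    have hk' : g (e' i) = 0 := by
      rw [← hGk, he', Pi.single_eq_of_ne (Ne.symm hi)]
    rw [← ha, map_smul, hk', smul_zero]
  have hexp : ∀ y : X, y = ∑ i, F i y • e i := by
    intro y
    refine (hbij F hF).1 (funext fun j => ?_)
    simp [he, Pi.single_apply]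
  have hgF : ∀ y, g y = F k y * g (e k) := by
    intro y
    conv_lhs => rw [hexp y, map_sum]
    rw [Finset.sum_eq_single k (fun i _ hi => by simp [hge i hi]) (by simp)]
    simp
  have hone : g (e k) = 1 := by
    have h1 := hgF (v k).rep
    rw [hg.2, (hF k).2] at h1
    have hne : ((‖(v k).rep‖ : ℝ) : 𝕜) ≠ 0 := by simpa using (v k).rep_nonzero
    exact mul_left_cancel₀ hne (by rw [← h1, mul_one])
  ext y
  rw [hgF y, hone, mul_one]

theorem isSmoothPt_rep_iff_hasSeparatingFamily {p : Projectivization 𝕜 X} :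
    IsSmoothPt 𝕜 p.rep ↔ HasSeparatingFamily (BJP 𝕜) (Module.finrank 𝕜 X) p :=
  ⟨IsSmoothPt.hasSeparatingFamily, HasSeparatingFamily.isSmoothPt⟩

variable (𝕜 X) in
theorem exists_family_forall_not_bjp :
    ∃ v : Fin (Module.finrank 𝕜 X) → Projectivization 𝕜 X, ∀ q, ¬ ∀ i, BJP 𝕜 (v i) q := by
  rcases subsingleton_or_nontrivial X with hX | hX
  · have h0 : Module.finrank 𝕜 X = 0 := Module.finrank_zero_of_subsingleton
    rw [h0]
    exact ⟨Fin.elim0, fun q => absurd (Subsingleton.elim _ _) q.rep_nonzero⟩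
  · obtain ⟨y, hy⟩ := exists_ne (0 : X)
    obtain ⟨p, hp, -⟩ := exists_isSmoothPt_rep_not_bjOrtho (𝕜 := 𝕜) hy
    obtain ⟨v, -, -, hv, -⟩ := hp.hasSeparatingFamily
    exact ⟨v, hv⟩

end Smoothness

theorem finiteDimensional_and_finrank_le_of_bjp_equiv {𝕜 X Y : Type*} [RCLike 𝕜]
    [NormedAddCommGroup X] [NormedSpace 𝕜 X] [NormedAddCommGroup Y] [NormedSpace 𝕜 Y]
    [FiniteDimensional 𝕜 X] (e : Projectivization 𝕜 X ≃ Projectivization 𝕜 Y)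
    (he : ∀ p q, BJP 𝕜 p q ↔ BJP 𝕜 (e p) (e q)) :
    FiniteDimensional 𝕜 Y ∧ Module.finrank 𝕜 Y ≤ Module.finrank 𝕜 X := by
  obtain ⟨v, hv⟩ := exists_family_forall_not_bjp 𝕜 X
  have := finiteDimensional_and_finrank_le_of_forall_not_bjp (e ∘ v) fun q hq =>
    hv (e.symm q) fun i => (he _ _).2 (by simpa using hq i)
  simpa using this

/-- If `X` is finite-dimensional and `Φ : ℙX → ℙY` is a bijection preserving BJ-orthogonality
in both directions, then `Y` is finite-dimensional, `dim X = dim Y`, and `Φ` maps the set of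
smooth projective points of `ℙX` onto the set of smooth projective points of `ℙY`. -/
theorem stmt2 {𝕜 X Y : Type*} [RCLike 𝕜] [NormedAddCommGroup X] [NormedSpace 𝕜 X]
    [NormedAddCommGroup Y] [NormedSpace 𝕜 Y] [FiniteDimensional 𝕜 X]
    (Φ : Projectivization 𝕜 X → Projectivization 𝕜 Y) (hbij : Function.Bijective Φ)
    (hpres : ∀ p q : Projectivization 𝕜 X, BJP 𝕜 p q ↔ BJP 𝕜 (Φ p) (Φ q)) :
    FiniteDimensional 𝕜 Y ∧ Module.finrank 𝕜 X = Module.finrank 𝕜 Y ∧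
      Φ '' {p : Projectivization 𝕜 X | IsSmoothPt 𝕜 p.rep}
        = {q : Projectivization 𝕜 Y | IsSmoothPt 𝕜 q.rep} := by
  let e := Equiv.ofBijective Φ hbij
  have he : ∀ p q, BJP 𝕜 p q ↔ BJP 𝕜 (e p) (e q) := hpres
  have he' : ∀ p q, BJP 𝕜 p q ↔ BJP 𝕜 (e.symm p) (e.symm q) := fun p q => by simp [he]
  obtain ⟨hY, hle⟩ := finiteDimensional_and_finrank_le_of_bjp_equiv e he
  have hrank : Module.finrank 𝕜 X = Module.finrank 𝕜 Y :=
    le_antisymm (finiteDimensional_and_finrank_le_of_bjp_equiv e.symm he').2 hle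
  refine ⟨hY, hrank, Set.Subset.antisymm ?_ ?_⟩
  · rintro _ ⟨p, hp, rfl⟩
    have h := (isSmoothPt_rep_iff_hasSeparatingFamily.1 hp).map e he
    rw [hrank] at h
    exact isSmoothPt_rep_iff_hasSeparatingFamily.2 h
  · intro q hq
    have h := (isSmoothPt_rep_iff_hasSeparatingFamily.1 hq).map e.symm he'
    rw [← hrank] at h
    exact ⟨e.symm q, isSmoothPt_rep_iff_hasSeparatingFamily.2 h, e.apply_symm_apply q⟩
end

section
/- Let X be a normed space over 𝔽 ∈ {ℝ, ℂ} of finite dimension n ≥ 1. Then there exist n nonzero smooth points x₁, …, xₙ of X whose outgoing neighborhoods x₁^⊥, …, xₙ^⊥ are pairwise distinct; in particular, the family of sets { x^⊥ : x ∈ X \ {0} and x is a smooth point } has at least n elements. -/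
theorem IsSuppFun.bjOrtho_of_apply_eq_zero {𝕜 X : Type*} [RCLike 𝕜] [NormedAddCommGroup X]
    [NormedSpace 𝕜 X] {f : X →L[𝕜] 𝕜} {x y : X} (hf : IsSuppFun 𝕜 f x) (hy : f y = 0) :
    BJOrtho 𝕜 x y := fun c => by
  simpa [hf.1, hf.2, hy] using f.le_opNorm (x + c • y)

section RealStructure

variable {𝕜 X : Type*} [RCLike 𝕜] [NormedAddCommGroup X] [NormedSpace 𝕜 X]
  [NormedSpace ℝ X] [IsScalarTower ℝ 𝕜 X]

/-- Where the norm is differentiable, its derivative is the real part of every supporting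
functional. -/
theorem IsSuppFun.re_apply_eq_fderiv {f : X →L[𝕜] 𝕜} {x : X} (hf : IsSuppFun 𝕜 f x)
    (hx : DifferentiableAt ℝ (fun z : X => ‖z‖) x) (y : X) :
    RCLike.re (f y) = fderiv ℝ (fun z : X => ‖z‖) x y := by
  let g : X →L[ℝ] ℝ := RCLike.reCLM.comp (f.restrictScalars ℝ)
  have hg : ∀ z, g z = RCLike.re (f z) := fun z => rfl
  have hmin : IsLocalMin (fun z : X => ‖z‖ - g z) x := by
    refine Filter.Eventually.of_forall fun z => ?_
    have h1 : RCLike.re (f z) ≤ ‖z‖ :=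
      (RCLike.re_le_norm _).trans (by simpa [hf.1] using f.le_opNorm z)
    simp only [hg, hf.2, RCLike.ofReal_re]
    linarith
  have h := hmin.hasFDerivAt_eq_zero (hx.hasFDerivAt.sub g.hasFDerivAt)
  have h' := DFunLike.congr_fun h y
  simp only [sub_apply, zero_apply, hg] at h'
  linarith

theorem isSmoothPt_of_differentiableAt_norm_s7 {x : X} (h0 : x ≠ 0)
    (hx : DifferentiableAt ℝ (fun z : X => ‖z‖) x) : IsSmoothPt 𝕜 x := by
  obtain ⟨f, hf1, hf2⟩ := exists_dual_vector 𝕜 x (norm_ne_zero_iff.2 h0)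
  have hf : IsSuppFun 𝕜 f x := ⟨hf1, hf2⟩
  refine ⟨h0, f, hf, fun g hg => ?_⟩
  ext y
  have h := (hg.re_apply_eq_fderiv hx (star (g y - f y) • y)).trans
    (hf.re_apply_eq_fderiv hx _).symm
  rw [← sub_eq_zero, ← map_sub, map_smul, map_smul, ← smul_sub, smul_eq_mul, RCLike.star_def,
    RCLike.conj_mul, ← RCLike.ofReal_pow, RCLike.ofReal_re] at h
  exact sub_eq_zero.1 (by simpa using h)

theorem IsSuppFun.bjOrtho_iff {f : X →L[𝕜] 𝕜} {x y : X} (hf : IsSuppFun 𝕜 f x)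
    (hx : DifferentiableAt ℝ (fun z : X => ‖z‖) x) : BJOrtho 𝕜 x y ↔ f y = 0 := by
  refine ⟨fun h => ?_, hf.bjOrtho_of_apply_eq_zero⟩
  set w : X := star (f y) • y
  have hline : HasDerivAt (fun t : ℝ => x + t • w) w 0 := by
    simpa using ((hasDerivAt_id (0 : ℝ)).smul_const w).const_add x
  have hx' : HasFDerivAt (fun z : X => ‖z‖) (fderiv ℝ (fun z : X => ‖z‖) x)
      (x + (0 : ℝ) • w) := by
    simpa using hx.hasFDerivAt
  have hmin : IsLocalMin ((fun z : X => ‖z‖) ∘ fun t : ℝ => x + t • w) 0 := by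
    refine Filter.Eventually.of_forall fun t => ?_
    simpa [w, smul_assoc] using h (t • star (f y))
  have hw := hmin.hasDerivAt_eq_zero (hx'.comp_hasDerivAt 0 hline)
  rw [← hf.re_apply_eq_fderiv hx, map_smul, smul_eq_mul, RCLike.star_def,
    RCLike.conj_mul, ← RCLike.ofReal_pow, RCLike.ofReal_re] at hw
  simpa using hw

end RealStructure

/-- The supporting functionals at the points of differentiability of the norm separate points. -/
theorem exists_isSuppFun_apply_ne_zero {𝕜 X : Type*} [RCLike 𝕜] [NormedAddCommGroup X]
    [NormedSpace 𝕜 X] [NormedSpace ℝ X] [FiniteDimensional ℝ X] {y : X} (hy : y ≠ 0) :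
    ∃ (x : X) (f : X →L[𝕜] 𝕜), x ≠ 0 ∧ DifferentiableAt ℝ (fun z : X => ‖z‖) x ∧
      IsSuppFun 𝕜 f x ∧ f y ≠ 0 := by
  obtain ⟨x, hx, hxy⟩ := (dense_differentiableAt_norm (E := X)).exists_dist_lt y
    (half_pos (norm_pos_iff.2 hy))
  rw [dist_eq_norm, norm_sub_rev] at hxy
  have hlt : ‖x - y‖ < ‖x‖ := by
    have := norm_sub_norm_le y x
    rw [norm_sub_rev] at this
    linarith
  have h0 : x ≠ 0 := norm_pos_iff.1 ((norm_nonneg _).trans_lt hlt)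
  obtain ⟨f, hf1, hf2⟩ := exists_dual_vector 𝕜 x (norm_ne_zero_iff.2 h0)
  refine ⟨x, f, h0, hx, ⟨hf1, hf2⟩, fun hfy => hlt.not_ge ?_⟩
  simpa [hf1, hf2, hfy] using f.le_opNorm (x - y)

theorem finrank_span_eq_of_separates {K V : Type*} [Field K] [AddCommGroup V] [Module K V]
    [FiniteDimensional K V] {s : Set (Module.Dual K V)} (hs : ∀ y : V, y ≠ 0 → ∃ φ ∈ s, φ y ≠ 0) :
    Module.finrank K (Submodule.span K s) = Module.finrank K V := by
  have h : (Submodule.span K s).dualCoannihilator = ⊥ := by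
    rw [Submodule.eq_bot_iff]
    intro y hy
    by_contra h0
    obtain ⟨φ, hφ, hne⟩ := hs y h0
    exact hne ((Submodule.mem_dualCoannihilator y).1 hy φ (Submodule.subset_span hφ))
  have := Subspace.finrank_add_finrank_dualCoannihilator_eq (Submodule.span K s)
  rwa [h, finrank_bot, add_zero] at this

theorem LinearIndependent.exists_apply_ne_zero_of_ne {K V ι : Type*} [Field K] [AddCommGroup V]
    [Module K V] {φ : ι → Module.Dual K V} (hφ : LinearIndependent K φ) {i j : ι} (hij : i ≠ j) :
    ∃ y, φ i y = 0 ∧ φ j y ≠ 0 := by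
  by_contra! h
  obtain ⟨x, hx⟩ : ∃ x, φ i x ≠ 0 := by
    by_contra! h0
    exact hφ.ne_zero i (LinearMap.ext h0)
  have hpair := (LinearIndepOn.pair_iff φ hij).1 (hφ.linearIndepOn _) (-φ j x) (φ i x) (by
    ext z
    have := h (φ i x • z - φ i z • x) (by simp [mul_comm])
    simp only [map_sub, map_smul, smul_eq_mul] at this
    simp only [LinearMap.add_apply, LinearMap.smul_apply, smul_eq_mul, LinearMap.zero_apply]
    linear_combination this)
  exact hx hpair.2

/-- In a finite-dimensional normed space of dimension `n ≥ 1` there are `n` smooth points with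
pairwise distinct outgoing neighborhoods; in particular, the family
`{x^⊥ : x smooth}` has at least `n` elements. -/
theorem stmt7 {𝕜 X : Type*} [RCLike 𝕜] [NormedAddCommGroup X] [NormedSpace 𝕜 X]
    [FiniteDimensional 𝕜 X] (hn : 1 ≤ Module.finrank 𝕜 X) :
    (∃ x : Fin (Module.finrank 𝕜 X) → X, (∀ i, IsSmoothPt 𝕜 (x i)) ∧
      ∀ i j, i ≠ j → {y : X | BJOrtho 𝕜 (x i) y} ≠ {y : X | BJOrtho 𝕜 (x j) y}) ∧
    (Module.finrank 𝕜 X : ℕ∞) ≤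
      {S : Set X | ∃ x : X, IsSmoothPt 𝕜 x ∧ S = {y : X | BJOrtho 𝕜 x y}}.encard := by
  let _ : NormedSpace ℝ X := NormedSpace.restrictScalars ℝ 𝕜 X
  have _ : IsScalarTower ℝ 𝕜 X := RestrictScalars.isScalarTower ℝ 𝕜 X
  have _ : FiniteDimensional ℝ X := FiniteDimensional.trans ℝ 𝕜 X
  have key : ∃ x : Fin (Module.finrank 𝕜 X) → X, (∀ i, IsSmoothPt 𝕜 (x i)) ∧
      ∀ i j, i ≠ j → {y : X | BJOrtho 𝕜 (x i) y} ≠ {y : X | BJOrtho 𝕜 (x j) y} := by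
    let s : Set (Module.Dual 𝕜 X) := {φ | ∃ (x : X) (f : X →L[𝕜] 𝕜), x ≠ 0 ∧
      DifferentiableAt ℝ (fun z : X => ‖z‖) x ∧ IsSuppFun 𝕜 f x ∧ (f : X →ₗ[𝕜] 𝕜) = φ}
    have hs : Module.finrank 𝕜 (Submodule.span 𝕜 s) = Module.finrank 𝕜 X := by
      refine finrank_span_eq_of_separates fun y hy => ?_
      obtain ⟨x, f, h0, hx, hf, hne⟩ := exists_isSuppFun_apply_ne_zero (𝕜 := 𝕜) hy
      exact ⟨f, ⟨x, f, h0, hx, hf, rfl⟩, hne⟩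
    obtain ⟨φ, hφs, -, hφ⟩ := Submodule.exists_fun_fin_finrank_span_eq 𝕜 s
    rw [← hs]
    choose x f h0 hx hf hfφ using hφs
    refine ⟨x, fun i => isSmoothPt_of_differentiableAt_norm_s7 (h0 i) (hx i), fun i j hij heq => ?_⟩
    obtain ⟨y, hyi, hyj⟩ := hφ.exists_apply_ne_zero_of_ne hij
    rw [← hfφ] at hyi hyj
    have hy : y ∈ {y : X | BJOrtho 𝕜 (x j) y} := heq ▸ (hf i).bjOrtho_of_apply_eq_zero hyi
    exact hyj (((hf j).bjOrtho_iff (hx j)).1 hy)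
  refine ⟨key, ?_⟩
  obtain ⟨x, hx, hne⟩ := key
  have hinj : Function.Injective fun i => {y : X | BJOrtho 𝕜 (x i) y} :=
    fun i j h => by_contra fun hij => hne i j hij h
  calc (Module.finrank 𝕜 X : ℕ∞)
      = (Set.range fun i => {y : X | BJOrtho 𝕜 (x i) y}).encard := by
        rw [← Set.image_univ, hinj.encard_image, Set.encard_univ]
        simp
    _ ≤ _ := by
        refine Set.encard_le_encard (Set.range_subset_iff.2 fun i => ?_)
        exact ⟨x i, hx i, rfl⟩
end

section
/- Let X be a normed space over 𝔽 ∈ {ℝ, ℂ} whose norm is rotund (strictly convex) or smooth. Then the norm on X is a BJ-norm: for all nonzero x, y ∈ X, if x^⊥ = y^⊥ and ^⊥x = ^⊥y, then x and y are linearly dependent. -/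
/-- If `w` is Birkhoff–James orthogonal to `x`, some supporting functional of `w` vanishes
at `x`. -/
theorem BJOrtho.exists_supporting_functional {𝕜 X : Type*} [RCLike 𝕜] [NormedAddCommGroup X]
    [NormedSpace 𝕜 X] {w x : X} (hw : w ≠ 0) (h : BJOrtho 𝕜 w x) :
    ∃ f : X →L[𝕜] 𝕜, (‖f‖ = 1 ∧ f w = (‖w‖ : 𝕜)) ∧ f x = 0 := by
  let S : Submodule 𝕜 X := Submodule.span 𝕜 {x}
  have hnorm : ‖(Submodule.Quotient.mk w : X ⧸ S)‖ = ‖w‖ := by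
    refine le_antisymm (Submodule.Quotient.norm_mk_le S w) ?_
    refine le_of_forall_pos_le_add fun ε hε => ?_
    obtain ⟨m, hm, hlt⟩ := Submodule.Quotient.norm_mk_lt (Submodule.Quotient.mk w : X ⧸ S) hε
    obtain ⟨c, hc⟩ := Submodule.mem_span_singleton.1 ((Submodule.Quotient.eq S).1 hm)
    have hmw : m = w + c • x := by rw [hc]; abel
    rw [hmw] at hlt
    exact (h c).trans hlt.le
  obtain ⟨g, hg, hgw⟩ := exists_dual_vector'' 𝕜 (Submodule.Quotient.mk w : X ⧸ S)
  let f₀ : X →ₗ[𝕜] 𝕜 := g.toLinearMap ∘ₗ S.mkQ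
  have hbound : ∀ z, ‖f₀ z‖ ≤ 1 * ‖z‖ := fun z =>
    (g.le_of_opNorm_le hg _).trans
      (mul_le_mul_of_nonneg_left (Submodule.Quotient.norm_mk_le S z) zero_le_one)
  let f : X →L[𝕜] 𝕜 := f₀.mkContinuous 1 hbound
  have hfw : f w = (‖w‖ : 𝕜) := by
    rw [← hnorm]
    exact hgw
  refine ⟨f, ⟨le_antisymm (f₀.mkContinuous_norm_le zero_le_one hbound) ?_, hfw⟩, ?_⟩
  · have hle := f.le_opNorm w
    rw [hfw, RCLike.norm_ofReal, abs_norm] at hle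
    exact le_of_mul_le_mul_right (by rwa [one_mul]) (norm_pos_iff.2 hw)
  · have hx : (Submodule.Quotient.mk x : X ⧸ S) = 0 :=
      (Submodule.Quotient.mk_eq_zero S).2 (Submodule.mem_span_singleton_self x)
    change g (Submodule.Quotient.mk x) = 0
    rw [hx, map_zero]

/-- Every line in the direction `x ≠ 0` contains a point Birkhoff–James orthogonal to `x`. -/
theorem exists_bjOrtho_add_smul {𝕜 X : Type*} [RCLike 𝕜] [NormedAddCommGroup X]
    [NormedSpace 𝕜 X] {x : X} (hx : x ≠ 0) (y : X) : ∃ c : 𝕜, BJOrtho 𝕜 (y + c • x) x := by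
  have hlim : Filter.Tendsto (fun c : 𝕜 => ‖y + c • x‖) (Filter.cocompact 𝕜) Filter.atTop := by
    refine Filter.tendsto_atTop_mono (f := fun c : 𝕜 => -‖y‖ + ‖c‖ * ‖x‖) (fun c => ?_)
      (Filter.tendsto_atTop_add_const_left _ _
        ((tendsto_norm_cocompact_atTop (E := 𝕜)).atTop_mul_const (norm_pos_iff.2 hx)))
    have hle := norm_sub_le (y + c • x) y
    rw [add_sub_cancel_left, norm_smul] at hle
    linarith
  obtain ⟨c, hc⟩ := Continuous.exists_forall_le (by fun_prop) hlim
  refine ⟨c, fun d => ?_⟩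
  rw [add_assoc, ← add_smul]
  exact hc (c + d)

/-- Every nonzero `x` is Birkhoff–James orthogonal to some `y - c • x`. -/
theorem exists_bjOrtho_sub_smul {𝕜 X : Type*} [RCLike 𝕜] [NormedAddCommGroup X]
    [NormedSpace 𝕜 X] {x : X} (hx : x ≠ 0) (y : X) : ∃ c : 𝕜, BJOrtho 𝕜 x (y - c • x) := by
  obtain ⟨f, hf, hfx⟩ := exists_dual_vector 𝕜 x (norm_ne_zero_iff.2 hx)
  have hx' : (‖x‖ : 𝕜) ≠ 0 := by simpa using hx
  refine ⟨f y / (‖x‖ : 𝕜), fun d => ?_⟩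
  have hle := f.le_opNorm (x + d • (y - (f y / (‖x‖ : 𝕜)) • x))
  have hval : f (x + d • (y - (f y / (‖x‖ : 𝕜)) • x)) = (‖x‖ : 𝕜) := by
    simp only [map_add, map_smul, map_sub, hfx, smul_eq_mul]
    field_simp
    ring
  rwa [hval, hf, one_mul, RCLike.norm_ofReal, abs_norm] at hle

/-- In a strictly convex space, if `x` and `y ≠ 0` are both Birkhoff–James orthogonal to
`y - c • x`, then that vector vanishes. -/
theorem eq_smul_of_bjOrtho_sub_smul {𝕜 X : Type*} [RCLike 𝕜] [NormedAddCommGroup X]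
    [NormedSpace 𝕜 X]
    (h : ∀ x y : X, ‖x‖ = 1 → ‖y‖ = 1 → ‖(2 : 𝕜)⁻¹ • (x + y)‖ = 1 → x = y)
    {x y : X} {c : 𝕜} (hy : y ≠ 0) (hxw : BJOrtho 𝕜 x (y - c • x))
    (hyw : BJOrtho 𝕜 y (y - c • x)) : y = c • x := by
  have hle : ‖y‖ ≤ ‖c • x‖ := by
    have := hyw (-1)
    rwa [neg_one_smul, ← sub_eq_add_neg, sub_sub_cancel] at this
  have hc : c ≠ 0 := by
    rintro rfl
    rw [zero_smul, norm_zero] at hle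
    exact hy (norm_le_zero_iff.1 hle)
  have hge : ‖c • x‖ ≤ ‖y‖ := by
    have hx := hxw c⁻¹
    rw [smul_sub, inv_smul_smul₀ hc, add_sub_cancel, norm_smul, norm_inv] at hx
    rw [norm_smul]
    exact (le_inv_mul_iff₀ (norm_pos_iff.2 hc)).1 hx
  have heq : ‖c • x‖ = ‖y‖ := le_antisymm hge hle
  have h2 : ‖(2 : 𝕜)⁻¹‖ = 2⁻¹ := by rw [norm_inv, RCLike.norm_ofNat]
  have hmid : ‖(2 : 𝕜)⁻¹ • (y + c • x)‖ = ‖y‖ := by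
    refine le_antisymm ?_ ?_
    · rw [norm_smul, h2]
      linarith [norm_add_le y (c • x)]
    · have hm := hyw (-(2 : 𝕜)⁻¹)
      have hrw : y + (-(2 : 𝕜)⁻¹) • (y - c • x) = (2 : 𝕜)⁻¹ • (y + c • x) := by
        module
      rwa [hrw] at hm
  have hypos : ‖y‖ ≠ 0 := norm_ne_zero_iff.2 hy
  have hr : ((‖y‖ : 𝕜)⁻¹) ≠ 0 := inv_ne_zero (by simpa using hy)
  have hrn : ‖((‖y‖ : 𝕜)⁻¹)‖ = ‖y‖⁻¹ := by rw [norm_inv, RCLike.norm_ofReal, abs_norm]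
  refine smul_right_injective X hr (h _ _ ?_ ?_ ?_)
  · rw [norm_smul, hrn, inv_mul_cancel₀ hypos]
  · rw [norm_smul, hrn, heq, inv_mul_cancel₀ hypos]
  · rw [← smul_add, smul_comm, norm_smul, hrn, hmid, inv_mul_cancel₀ hypos]

/-- If the norm is rotund (strictly convex) or smooth, then it is a BJ-norm: nonzero vectors
with the same outgoing and incoming BJ-orthogonality neighborhoods are linearly dependent. -/
theorem stmt12 {𝕜 X : Type*} [RCLike 𝕜] [NormedAddCommGroup X] [NormedSpace 𝕜 X]
    (h : (∀ x y : X, ‖x‖ = 1 → ‖y‖ = 1 → ‖(2 : 𝕜)⁻¹ • (x + y)‖ = 1 → x = y) ∨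
         (∀ x : X, x ≠ 0 → ∃! f : X →L[𝕜] 𝕜, ‖f‖ = 1 ∧ f x = (‖x‖ : 𝕜))) :
    ∀ x y : X, x ≠ 0 → y ≠ 0 →
      {w : X | BJOrtho 𝕜 x w} = {w : X | BJOrtho 𝕜 y w} →
      {w : X | BJOrtho 𝕜 w x} = {w : X | BJOrtho 𝕜 w y} →
      ¬ LinearIndependent 𝕜 ![x, y] := by
  intro x y hx hy hout hin hli
  rw [LinearIndependent.pair_iff' hx] at hli
  rcases h with hrot | hsm
  · obtain ⟨c, hc⟩ := exists_bjOrtho_sub_smul (𝕜 := 𝕜) hx y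
    have hc' : BJOrtho 𝕜 y (y - c • x) := hout.subset hc
    exact hli c (eq_smul_of_bjOrtho_sub_smul hrot hy hc hc').symm
  · obtain ⟨c, hc⟩ := exists_bjOrtho_add_smul (𝕜 := 𝕜) hx y
    have hc' : BJOrtho 𝕜 (y + c • x) y := hin.subset hc
    have hw : y + c • x ≠ 0 := fun h0 =>
      hli (-c) (by rw [neg_smul]; exact (eq_neg_of_add_eq_zero_left h0).symm)
    obtain ⟨f, hf, hfx⟩ := hc.exists_supporting_functional hw
    obtain ⟨g, hg, hgy⟩ := hc'.exists_supporting_functional hw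
    obtain rfl := (hsm _ hw).unique hf hg
    have hzero : f (y + c • x) = 0 := by rw [map_add, map_smul, hfx, hgy, smul_zero, add_zero]
    rw [hf.2] at hzero
    exact hw (by simpa only [RCLike.ofReal_eq_zero, norm_eq_zero] using hzero)
end
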